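/- Let λ_R be the first eigenvalue of -Δw = λ w/|x|² with Dirichlet boundary conditions on the annulus Ω_R = {x ∈ ℝᴺ : R < |x| < R+1}, N ≥ 3. Then λ_R / R² → π² as R → ∞. -/

import Mathlib

open Real Set MeasureTheory Filter Topology

section EuclideanAnnulus

variable {E : Type*} [NormedAddCommGroup E]

theorem contDiff_of_forall_mem_tsupport [NormedSpace ℝ E] {f : E → ℝ} {n : WithTop ℕ∞}
    (hf : ∀ x ∈ tsupport f, ContDiffAt ℝ n f x) : ContDiff ℝ n f := by
  rw [contDiff_iff_contDiffAt]
  intro x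
  by_cases hx : x ∈ tsupport f
  · exact hf x hx
  · exact contDiffAt_const.congr_of_eventuallyEq (notMem_tsupport_iff_eventuallyEq.1 hx)

variable [InnerProductSpace ℝ E] [FiniteDimensional ℝ E] [MeasurableSpace E] [BorelSpace E]

/-- The divergence of the compactly supported field `h x • x` has zero integral. -/
theorem integral_fderiv_apply_self_add_finrank_mul {h : E → ℝ} (hh : ContDiff ℝ 1 h)
    (hc : HasCompactSupport h) :
    ∫ x, (fderiv ℝ h x x + Module.finrank ℝ E * h x) = 0 := by
  let b := stdOrthonormalBasis ℝ E
  have hd : Continuous (fderiv ℝ h) := hh.continuous_fderiv one_ne_zero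
  have hI (i) : Integrable (fun x : E => fderiv ℝ h x (b i) * innerSL ℝ (b i) x) := by
    refine Continuous.integrable_of_hasCompactSupport (by fun_prop) ?_
    exact (hc.fderiv_apply (𝕜 := ℝ) (b i)).mul_right
  have hh_int : Integrable h := hh.continuous.integrable_of_hasCompactSupport hc
  have hb (i) : innerSL ℝ (b i) (b i) = 1 := by simp
  have key (i) : ∫ x : E, fderiv ℝ h x (b i) * innerSL ℝ (b i) x = - ∫ x, h x := by
    have := integral_mul_fderiv_eq_neg_fderiv_mul_of_integrable (μ := (volume : Measure E))
      (f := h) (g := fun x => innerSL ℝ (b i) x) (v := b i) (hI i)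
      (by simpa only [ContinuousLinearMap.fderiv, hb, mul_one] using hh_int)
      (Continuous.integrable_of_hasCompactSupport (by have := hh.continuous; fun_prop)
        hc.mul_right)
      (fun x _ => hh.differentiable one_ne_zero x)
      (fun x _ => (innerSL ℝ (b i)).differentiableAt)
    simp only [ContinuousLinearMap.fderiv] at this
    rw [← neg_eq_iff_eq_neg, ← this]
    simp only [hb, mul_one]
  have hsum (x : E) : fderiv ℝ h x x = ∑ i, fderiv ℝ h x (b i) * innerSL ℝ (b i) x := by
    have := congrArg (fderiv ℝ h x) (b.sum_repr' x)
    rw [map_sum] at this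
    simpa [mul_comm] using this.symm
  simp_rw [hsum]
  rw [integral_add (integrable_finsetSum _ fun i _ => hI i) (hh_int.const_mul _),
    integral_finsetSum _ fun i _ => hI i, integral_const_mul]
  simp only [key]
  simp

/-- Integration of a radial function over an annulus. -/
theorem setIntegral_annulus_fun_norm [Nontrivial E] (f : ℝ → ℝ) {a b : ℝ} (ha : 0 ≤ a)
    (hab : a ≤ b) :
    ∫ x in {x : E | a < ‖x‖ ∧ ‖x‖ < b}, f ‖x‖ =
      (Module.finrank ℝ E * (volume : Measure E).real (Metric.ball 0 1)) *
        ∫ r in a..b, r ^ (Module.finrank ℝ E - 1) * f r := by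
  have hm : MeasurableSet {x : E | a < ‖x‖ ∧ ‖x‖ < b} :=
    ((isOpen_lt continuous_const continuous_norm).inter
      (isOpen_lt continuous_norm continuous_const)).measurableSet
  have := integral_fun_norm_addHaar (volume : Measure E) ((Ioo a b).indicator f)
  rw [← integral_indicator hm]
  have e : ({x : E | a < ‖x‖ ∧ ‖x‖ < b}.indicator fun x => f ‖x‖) =
      fun x => (Ioo a b).indicator f ‖x‖ := by
    ext x
    simp [indicator]
  rw [e, this, intervalIntegral.integral_of_le hab, integral_Ioc_eq_integral_Ioo, nsmul_eq_mul,
    smul_eq_mul, ← mul_assoc]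
  congr 1
  have e2 : (fun y : ℝ => y ^ (Module.finrank ℝ E - 1) • (Ioo a b).indicator f y) =
      (Ioo a b).indicator fun y => y ^ (Module.finrank ℝ E - 1) * f y := by
    ext y
    simp [indicator]
  rw [e2, setIntegral_indicator measurableSet_Ioo]
  congr 2
  exact inter_eq_right.2 fun y hy => ha.trans_lt hy.1

end EuclideanAnnulus

/-- The radial field `φ' / (r φ)` attached to `φ r = r ^ (-(n - 1) / 2) * sin (π * (r - R))`. -/
noncomputable def hardyField (n R r : ℝ) : ℝ :=
  (π * cos (π * (r - R)) / sin (π * (r - R)) - (n - 1) / (2 * r)) / r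

theorem sin_pi_mul_sub_pos {R r : ℝ} (h₁ : R < r) (h₂ : r < R + 1) : 0 < sin (π * (r - R)) :=
  sin_pos_of_pos_of_lt_pi (by have := pi_pos; have : 0 < r - R := by linarith
                              positivity) (by nlinarith [pi_pos])

theorem contDiffAt_hardyField (n : ℝ) {R r : ℝ} (hr : r ≠ 0) (hs : sin (π * (r - R)) ≠ 0) :
    ContDiffAt ℝ 1 (hardyField n R) r := by
  have : ContDiffAt ℝ 1 (fun r => cos (π * (r - R))) r := by fun_prop
  have : ContDiffAt ℝ 1 (fun r => sin (π * (r - R))) r := by fun_prop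
  unfold hardyField
  fun_prop (disch := simp_all)

/-- The Riccati inequality satisfied by `hardyField`. -/
theorem hardyField_riccati {n R r : ℝ} (hn : 3 ≤ n) (hr : 0 < r)
    (hs : sin (π * (r - R)) ≠ 0) :
    π ^ 2 ≤ -(deriv (hardyField n R) r * r + n * hardyField n R r
      + hardyField n R r ^ 2 * r ^ 2) := by
  have hd : HasDerivAt (hardyField n R) _ r :=
    ((((((hasDerivAt_id r).sub_const R).const_mul π).cos.const_mul π).div
      (((hasDerivAt_id r).sub_const R).const_mul π).sin hs).sub
      ((hasDerivAt_const r (n - 1)).div ((hasDerivAt_id r).const_mul 2)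
        (by simp [hr.ne']))).div (hasDerivAt_id r) hr.ne'
  have hnn : 0 ≤ (n - 1) * (n - 3) / (4 * r ^ 2) := by
    have : 0 ≤ (n - 1) * (n - 3) := mul_nonneg (by linarith) (by linarith)
    positivity
  suffices h : -(deriv (hardyField n R) r * r + n * hardyField n R r
      + hardyField n R r ^ 2 * r ^ 2) = π ^ 2 + (n - 1) * (n - 3) / (4 * r ^ 2) by linarith
  rw [hd.deriv, hardyField]
  simp only [id, Pi.sub_apply, Pi.div_apply]
  have hr' := hr.ne'
  generalize sin (π * (r - R)) = s at *
  generalize cos (π * (r - R)) = c at *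
  field_simp
  ring

theorem hasDerivAt_max_zero_sq (u : ℝ) :
    HasDerivAt (fun u : ℝ => max u 0 ^ 2) (2 * max u 0) u := by
  rcases lt_trichotomy u 0 with hu | rfl | hu
  · rw [max_eq_right hu.le, mul_zero]
    refine (hasDerivAt_const u (0 : ℝ)).congr_of_eventuallyEq ?_
    filter_upwards [Iio_mem_nhds hu] with v hv
    simp [max_eq_right (mem_Iio.1 hv).le]
  · rw [hasDerivAt_iff_isLittleO]
    simp only [max_self, sub_zero, mul_zero, smul_zero, ne_eq, OfNat.ofNat_ne_zero,
      not_false_eq_true, zero_pow]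
    refine Asymptotics.IsBigO.trans_isLittleO (g := fun x : ℝ => x ^ 2) ?_ ?_
    · refine Asymptotics.IsBigO.of_bound 1 (Eventually.of_forall fun x => ?_)
      rw [norm_pow, norm_pow, one_mul]
      gcongr
      rw [norm_eq_abs, norm_eq_abs, abs_of_nonneg (le_max_right _ _)]
      exact max_le (le_abs_self x) (abs_nonneg x)
    · exact Asymptotics.isLittleO_pow_id one_lt_two
  · rw [max_eq_left hu.le]
    have : HasDerivAt (fun u : ℝ => u ^ 2) (2 * u) u := by simpa using hasDerivAt_pow 2 u
    refine this.congr_of_eventuallyEq ?_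
    filter_upwards [Ioi_mem_nhds hu] with v hv
    simp [max_eq_left (mem_Ioi.1 hv).le]

theorem contDiff_max_zero_sq : ContDiff ℝ 1 fun u : ℝ => max u 0 ^ 2 := by
  rw [contDiff_one_iff_deriv]
  refine ⟨fun u => (hasDerivAt_max_zero_sq u).differentiableAt, ?_⟩
  rw [funext fun u => (hasDerivAt_max_zero_sq u).deriv]
  fun_prop

/-- A `C¹` approximation of the identity of `(0, ∞)` which vanishes on `(0, δ]`. -/
noncomputable def softCut (δ s : ℝ) : ℝ := max (s - δ) 0 ^ 2 / s

theorem softCut_eq_zero {δ s : ℝ} (h : s ≤ δ) : softCut δ s = 0 := by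
  simp [softCut, h]

theorem contDiffAt_softCut (δ : ℝ) {s : ℝ} (hs : s ≠ 0) : ContDiffAt ℝ 1 (softCut δ) s := by
  have := contDiff_max_zero_sq.comp (contDiff_id.sub contDiff_const : ContDiff ℝ 1 fun s => s - δ)
  exact this.contDiffAt.div contDiffAt_id hs

theorem abs_deriv_softCut_le {δ s : ℝ} (hδ : 0 ≤ δ) (hs : 0 < s) :
    |deriv (softCut δ) s| ≤ 1 := by
  have h1 : HasDerivAt (fun s => max (s - δ) 0 ^ 2) (2 * max (s - δ) 0) s :=
    (hasDerivAt_max_zero_sq (s - δ)).comp_sub_const s δ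
  have h2 : HasDerivAt (softCut δ) _ s := h1.div (hasDerivAt_id' s) hs.ne'
  rw [h2.deriv]
  rcases le_total s δ with h | h
  · simp [h]
  · rw [max_eq_left (by linarith), abs_le]
    constructor
    · rw [le_div_iff₀ (by positivity)]
      nlinarith
    · rw [div_le_one (by positivity)]
      nlinarith

theorem sq_sub_le_softCut_sq {δ s : ℝ} (hδ : 0 ≤ δ) (hs : 0 < s) :
    s ^ 2 - 4 * δ * s ≤ softCut δ s ^ 2 := by
  rcases le_total s δ with h | h
  · rw [softCut_eq_zero h]
    nlinarith
  · rw [softCut, max_eq_left (by linarith), div_pow, le_div_iff₀ (by positivity)]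
    nlinarith [mul_nonneg hδ hs.le, mul_nonneg (sq_nonneg δ) (sq_nonneg (s - δ)),
      mul_nonneg (sq_nonneg δ) (mul_nonneg hs.le (sub_nonneg.2 h)),
      mul_nonneg (sq_nonneg δ) (mul_nonneg hs.le hs.le)]

section AnnulusHardy

variable {E : Type*} [NormedAddCommGroup E]

theorem isOpen_annulus (a b : ℝ) : IsOpen {x : E | a < ‖x‖ ∧ ‖x‖ < b} :=
  (isOpen_lt continuous_const continuous_norm).inter (isOpen_lt continuous_norm continuous_const)

/-- The radial profile `softCut δ (sin (π * (‖x‖ - R)))` cut off outside the annulus. -/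
noncomputable def annulusTest (R δ : ℝ) (x : E) : ℝ :=
  {x : E | R < ‖x‖ ∧ ‖x‖ < R + 1}.indicator (fun x => softCut δ (sin (π * (‖x‖ - R)))) x

theorem annulusTest_eventuallyEq {R : ℝ} (δ : ℝ) {x : E} (hx : R < ‖x‖ ∧ ‖x‖ < R + 1) :
    annulusTest R δ =ᶠ[𝓝 x] fun x => softCut δ (sin (π * (‖x‖ - R))) := by
  filter_upwards [(isOpen_annulus R (R + 1)).mem_nhds hx] with y hy
  rw [annulusTest, indicator_of_mem]
  exact hy

variable [InnerProductSpace ℝ E]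

theorem norm_fderiv_annulusTest_le {R δ : ℝ} (hR : 0 < R) (hδ : 0 < δ) {x : E}
    (hx : R < ‖x‖ ∧ ‖x‖ < R + 1) :
    ‖fderiv ℝ (annulusTest R δ) x‖ ≤ π * |cos (π * (‖x‖ - R))| := by
  rw [(annulusTest_eventuallyEq δ hx).fderiv_eq]
  have hs := sin_pi_mul_sub_pos hx.1 hx.2
  have hn : DifferentiableAt ℝ (fun x : E => ‖x‖) x :=
    (contDiffAt_norm (n := 1) ℝ (norm_pos_iff.1 (hR.trans hx.1))).differentiableAt one_ne_zero
  have hnorm : ‖fderiv ℝ (fun x : E => ‖x‖) x‖ ≤ 1 := by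
    simpa using norm_fderiv_le_of_lipschitz ℝ (lipschitzWith_one_norm (E := E)) (x₀ := x)
  have h1 : HasDerivAt (fun r => sin (π * (r - R))) (cos (π * (‖x‖ - R)) * (π * 1)) ‖x‖ :=
    (((hasDerivAt_id' ‖x‖).sub_const R).const_mul π).sin
  have h2 := ((contDiffAt_softCut δ hs.ne').differentiableAt one_ne_zero).hasDerivAt
  have h3 : HasFDerivAt (fun x : E => softCut δ (sin (π * (‖x‖ - R)))) _ x :=
    HasDerivAt.comp_hasFDerivAt (h₂ := softCut δ ∘ fun r => sin (π * (r - R))) x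
      (h2.comp ‖x‖ h1) hn.hasFDerivAt
  rw [h3.fderiv, norm_smul, norm_eq_abs, abs_mul, abs_mul, mul_one, abs_of_pos pi_pos]
  have h4 := abs_deriv_softCut_le hδ.le hs
  calc _ ≤ 1 * (|cos (π * (‖x‖ - R))| * π) * 1 := by gcongr
    _ = _ := by ring

variable [FiniteDimensional ℝ E]

theorem isCompact_closed_annulus (a b : ℝ) : IsCompact {x : E | a ≤ ‖x‖ ∧ ‖x‖ ≤ b} := by
  refine (isCompact_closedBall (0 : E) b).of_isClosed_subset ?_ fun x hx => by simpa using hx.2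
  exact (isClosed_le continuous_const continuous_norm).inter
    (isClosed_le continuous_norm continuous_const)

theorem norm_gradient_eq_norm_fderiv (w : E → ℝ) (x : E) : ‖gradient w x‖ = ‖fderiv ℝ w x‖ := by
  simp [gradient]

theorem tsupport_annulusTest_subset {R δ : ℝ} (hδ : 0 < δ) :
    tsupport (annulusTest R δ : E → ℝ) ⊆ {x | R < ‖x‖ ∧ ‖x‖ < R + 1} := by
  have hK : IsClosed ({x : E | R ≤ ‖x‖ ∧ ‖x‖ ≤ R + 1} ∩ {x | δ ≤ sin (π * (‖x‖ - R))}) :=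
    (isCompact_closed_annulus R (R + 1)).isClosed.inter
      (isClosed_le continuous_const (by fun_prop))
  refine (closure_minimal ?_ hK).trans ?_
  · intro x hx
    have hmem : x ∈ {x : E | R < ‖x‖ ∧ ‖x‖ < R + 1} := by
      by_contra h
      exact hx (indicator_of_notMem h _)
    refine ⟨⟨hmem.1.le, hmem.2.le⟩, ?_⟩
    by_contra h
    refine hx ?_
    rw [annulusTest, indicator_of_mem hmem, softCut_eq_zero (not_le.1 h).le]
  · rintro x ⟨⟨h1, h2⟩, h3 : δ ≤ sin _⟩
    refine ⟨lt_of_le_of_ne h1 fun h => ?_, lt_of_le_of_ne h2 fun h => ?_⟩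
    · rw [← h, sub_self, mul_zero, sin_zero] at h3
      linarith
    · rw [h, add_sub_cancel_left, mul_one, sin_pi] at h3
      linarith

theorem contDiff_annulusTest {R δ : ℝ} (hR : 0 < R) (hδ : 0 < δ) :
    ContDiff ℝ 1 (annulusTest R δ : E → ℝ) := by
  refine contDiff_of_forall_mem_tsupport fun x hx => ?_
  have hx' := tsupport_annulusTest_subset hδ hx
  refine ContDiffAt.congr_of_eventuallyEq ?_ (annulusTest_eventuallyEq δ hx')
  have hn : ContDiffAt ℝ 1 (fun x : E => ‖x‖) x :=
    contDiffAt_norm ℝ (norm_pos_iff.1 (hR.trans hx'.1))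
  exact (contDiffAt_softCut δ (sin_pi_mul_sub_pos hx'.1 hx'.2).ne').comp x
    (contDiffAt_const.mul (hn.sub contDiffAt_const)).sin

variable [MeasurableSpace E] [BorelSpace E]

/-- The Hardy constant of the annulus `R < ‖x‖ < R + 1` is at least `π ^ 2 * R ^ 2`. -/
theorem annulus_hardy_inequality (hE : 3 ≤ Module.finrank ℝ E) {R : ℝ} (hR : 0 < R) {w : E → ℝ}
    (hw : ContDiff ℝ 1 w) (hc : HasCompactSupport w)
    (hsupp : tsupport w ⊆ {x | R < ‖x‖ ∧ ‖x‖ < R + 1}) :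
    π ^ 2 * R ^ 2 * ∫ x in {x : E | R < ‖x‖ ∧ ‖x‖ < R + 1}, w x ^ 2 / ‖x‖ ^ 2 ≤
      ∫ x in {x : E | R < ‖x‖ ∧ ‖x‖ < R + 1}, ‖gradient w x‖ ^ 2 := by
  set n : ℝ := (Module.finrank ℝ E : ℝ) with hn
  have hn3 : 3 ≤ n := by rw [hn]; exact_mod_cast hE
  set k := hardyField n R
  set h : E → ℝ := fun x => w x ^ 2 * k ‖x‖ with hh
  have hts : tsupport h ⊆ tsupport w := by
    refine closure_mono fun x hx hwx => hx ?_
    simp [hh, hwx]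
  have hpos {x : E} (hx : x ∈ tsupport w) : 0 < ‖x‖ := hR.trans (hsupp hx).1
  have hsin {x : E} (hx : x ∈ tsupport w) : sin (π * (‖x‖ - R)) ≠ 0 :=
    (sin_pi_mul_sub_pos (hsupp hx).1 (hsupp hx).2).ne'
  have hk {x : E} (hx : x ∈ tsupport w) : ContDiffAt ℝ 1 k ‖x‖ :=
    contDiffAt_hardyField n (hpos hx).ne' (hsin hx)
  have hnorm {x : E} (hx : x ∈ tsupport w) : ContDiffAt ℝ 1 (fun x : E => ‖x‖) x :=
    contDiffAt_norm ℝ (norm_pos_iff.1 (hpos hx))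
  have hhd : ContDiff ℝ 1 h := contDiff_of_forall_mem_tsupport fun x hx =>
    (hw.contDiffAt.pow 2).mul ((hk (hts hx)).comp x (hnorm (hts hx)))
  have hhc : HasCompactSupport h := hc.of_isClosed_subset (isClosed_tsupport _) hts
  have hgrad : ∀ x ∉ tsupport w, fderiv ℝ w x = 0 := fun x hx =>
    image_eq_zero_of_notMem_tsupport fun hx' => hx (tsupport_fderiv_subset ℝ hx')
  have hderiv {x : E} (hx : x ∈ tsupport w) : fderiv ℝ h x x =
      2 * w x * fderiv ℝ w x x * k ‖x‖ + w x ^ 2 * (deriv k ‖x‖ * ‖x‖) := by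
    have hwx := (hw.differentiable one_ne_zero x).hasFDerivAt
    have hnx := ((hnorm hx).differentiableAt one_ne_zero)
    have hkx := ((hk hx).differentiableAt one_ne_zero).hasDerivAt
    have := ((hwx.pow 2).mul (hkx.comp_hasFDerivAt x hnx.hasFDerivAt)).fderiv
    have e : h = (fun x => w x ^ 2) * (k ∘ fun x => ‖x‖) := rfl
    rw [e, this]
    simp only [Function.comp_apply, add_apply, smul_apply, hnx.fderiv_norm_self, smul_eq_mul]
    ring
  have hI₁ : Integrable fun x => ‖fderiv ℝ w x‖ ^ 2 := by
    refine Continuous.integrable_of_hasCompactSupport ?_ ?_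
    · exact (hw.continuous_fderiv one_ne_zero).norm.pow 2
    · exact (hc.fderiv (𝕜 := ℝ)).norm.comp_left (g := fun t : ℝ => t ^ 2) (by simp)
  have hI₂ : Integrable fun x => fderiv ℝ h x x + n * h x := by
    refine Continuous.integrable_of_hasCompactSupport ?_ ?_
    · have := hhd.continuous_fderiv one_ne_zero
      have := hhd.continuous
      fun_prop
    · refine HasCompactSupport.of_support_subset_isCompact hhc.isCompact fun x hx => ?_
      by_contra hx'
      refine hx ?_
      have h0 : fderiv ℝ h x = 0 :=
        image_eq_zero_of_notMem_tsupport fun h' => hx' (tsupport_fderiv_subset ℝ h')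
      simp [h0, image_eq_zero_of_notMem_tsupport hx']
  rw [setIntegral_eq_integral_of_forall_compl_eq_zero,
    setIntegral_eq_integral_of_forall_compl_eq_zero, ← integral_const_mul]
  rotate_left
  · intro x hx
    simp [norm_gradient_eq_norm_fderiv, hgrad x fun hx' => hx (hsupp hx')]
  · intro x hx
    simp [image_eq_zero_of_notMem_tsupport fun hx' => hx (hsupp hx')]
  simp_rw [norm_gradient_eq_norm_fderiv]
  have key : ∫ x, (‖fderiv ℝ w x‖ ^ 2 - (fderiv ℝ h x x + n * h x)) = ∫ x, ‖fderiv ℝ w x‖ ^ 2 := by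
    rw [integral_sub hI₁ hI₂, integral_fderiv_apply_self_add_finrank_mul hhd hhc, sub_zero]
  rw [← key]
  refine integral_mono_of_nonneg (Eventually.of_forall fun x => by positivity) (hI₁.sub hI₂)
    (Eventually.of_forall fun x => ?_)
  change π ^ 2 * R ^ 2 * (w x ^ 2 / ‖x‖ ^ 2) ≤ ‖fderiv ℝ w x‖ ^ 2 - (fderiv ℝ h x x + n * h x)
  by_cases hx : x ∈ tsupport w
  swap
  · have h0 : fderiv ℝ h x = 0 :=
      image_eq_zero_of_notMem_tsupport fun h' => hx (hts (tsupport_fderiv_subset ℝ h'))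
    rw [h0]
    simp [hh, hgrad x hx, image_eq_zero_of_notMem_tsupport hx]
  have hr := hpos hx
  rw [hderiv hx]
  have hric := hardyField_riccati hn3 hr (hsin hx)
  have hop : |fderiv ℝ w x x| ≤ ‖fderiv ℝ w x‖ * ‖x‖ := (fderiv ℝ w x).le_opNorm x
  have h1 : π ^ 2 * R ^ 2 * (w x ^ 2 / ‖x‖ ^ 2) ≤ π ^ 2 * w x ^ 2 := by
    have : R ^ 2 / ‖x‖ ^ 2 ≤ 1 := by
      rw [div_le_one (by positivity)]
      exact pow_le_pow_left₀ hR.le (hsupp hx).1.le 2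
    calc π ^ 2 * R ^ 2 * (w x ^ 2 / ‖x‖ ^ 2) = π ^ 2 * w x ^ 2 * (R ^ 2 / ‖x‖ ^ 2) := by ring
      _ ≤ π ^ 2 * w x ^ 2 * 1 := by gcongr
      _ = _ := mul_one _
  have h2 : (fderiv ℝ w x x / ‖x‖) ^ 2 ≤ ‖fderiv ℝ w x‖ ^ 2 := by
    rw [sq_le_sq, abs_div, abs_norm, abs_norm, div_le_iff₀ hr]
    exact hop
  have h3 := sq_nonneg (fderiv ℝ w x x / ‖x‖ - w x * k ‖x‖ * ‖x‖)
  have h4 : fderiv ℝ w x x / ‖x‖ * ‖x‖ = fderiv ℝ w x x := div_mul_cancel₀ _ hr.ne'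
  have h5 := mul_le_mul_of_nonneg_left hric (sq_nonneg (w x))
  have h6 : (fderiv ℝ w x x / ‖x‖ - w x * k ‖x‖ * ‖x‖) ^ 2 = (fderiv ℝ w x x / ‖x‖) ^ 2
      - 2 * w x * fderiv ℝ w x x * k ‖x‖ + w x ^ 2 * (k ‖x‖ ^ 2 * ‖x‖ ^ 2) := by
    linear_combination (-2 * w x * k ‖x‖) * h4
  simp only [hh]
  linarith

theorem ContinuousOn.integrableOn_annulus {f : E → ℝ} {a b : ℝ}
    (hf : ContinuousOn f {x | a ≤ ‖x‖ ∧ ‖x‖ ≤ b}) :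
    IntegrableOn f {x | a < ‖x‖ ∧ ‖x‖ < b} :=
  (hf.integrableOn_compact (isCompact_closed_annulus a b)).mono_set
    fun _ hx => ⟨hx.1.le, hx.2.le⟩

theorem integral_sin_pi_mul_sub_sq (R : ℝ) : ∫ r in R..R + 1, sin (π * (r - R)) ^ 2 = 1 / 2 := by
  rw [intervalIntegral.integral_comp_sub_right (fun r => sin (π * r) ^ 2),
    intervalIntegral.integral_comp_mul_left (fun r => sin r ^ 2) pi_ne_zero]
  simp [integral_sin_sq]
  field_simp

theorem integral_cos_pi_mul_sub_sq (R : ℝ) : ∫ r in R..R + 1, cos (π * (r - R)) ^ 2 = 1 / 2 := by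
  rw [intervalIntegral.integral_comp_sub_right (fun r => cos (π * r) ^ 2),
    intervalIntegral.integral_comp_mul_left (fun r => cos r ^ 2) pi_ne_zero]
  simp [integral_cos_sq]
  field_simp

/-- The Rayleigh quotient of `annulusTest`. -/
theorem annulusTest_rayleigh_bounds [Nontrivial E] {R δ : ℝ} (hR : 0 < R) (hδ : 0 < δ) {m : ℕ}
    (hm : m = Module.finrank ℝ E - 1) (hRδ : 0 < R ^ m / 2 - 4 * δ * (R + 1) ^ m) :
    0 < ∫ x in {x : E | R < ‖x‖ ∧ ‖x‖ < R + 1}, annulusTest R δ x ^ 2 / ‖x‖ ^ 2 ∧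
    (∫ x in {x : E | R < ‖x‖ ∧ ‖x‖ < R + 1}, ‖gradient (annulusTest R δ) x‖ ^ 2) /
      ∫ x in {x : E | R < ‖x‖ ∧ ‖x‖ < R + 1}, annulusTest R δ x ^ 2 / ‖x‖ ^ 2 ≤
      (R + 1) ^ m * (π ^ 2 / 2) * (R + 1) ^ 2 / (R ^ m / 2 - 4 * δ * (R + 1) ^ m) := by
  set Ω := {x : E | R < ‖x‖ ∧ ‖x‖ < R + 1}
  have hΩ : MeasurableSet Ω := (isOpen_annulus R (R + 1)).measurableSet
  set C : ℝ := Module.finrank ℝ E * (volume : Measure E).real (Metric.ball 0 1) with hC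
  have hCpos : 0 < C := by
    have h1 : 0 < (volume : Measure E).real (Metric.ball 0 1) :=
      ENNReal.toReal_pos (Metric.measure_ball_pos _ _ one_pos).ne' measure_ball_lt_top.ne
    have h2 : 0 < Module.finrank ℝ E := Module.finrank_pos
    positivity
  have hRR : R ≤ R + 1 := by linarith
  have hnum : ∫ x in Ω, ‖gradient (annulusTest R δ) x‖ ^ 2 ≤ C * ((R + 1) ^ m * (π ^ 2 / 2)) := by
    calc ∫ x in Ω, ‖gradient (annulusTest R δ) x‖ ^ 2
        ≤ ∫ x in Ω, (fun r => π ^ 2 * cos (π * (r - R)) ^ 2) ‖x‖ := by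
          refine integral_mono_of_nonneg (Eventually.of_forall fun x => by positivity)
            (ContinuousOn.integrableOn_annulus (by fun_prop)) ?_
          filter_upwards [ae_restrict_mem hΩ] with x hx
          rw [norm_gradient_eq_norm_fderiv, ← sq_abs (cos _), ← mul_pow]
          exact pow_le_pow_left₀ (norm_nonneg _) (norm_fderiv_annulusTest_le hR hδ hx) 2
      _ = C * ∫ r in R..R + 1, r ^ m * (π ^ 2 * cos (π * (r - R)) ^ 2) := by
          rw [hm, hC]
          exact setIntegral_annulus_fun_norm (E := E)
            (fun r => π ^ 2 * cos (π * (r - R)) ^ 2) hR.le hRR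
      _ ≤ C * ∫ r in R..R + 1, (R + 1) ^ m * (π ^ 2 * cos (π * (r - R)) ^ 2) := by
          gcongr
          refine intervalIntegral.integral_mono_on hRR ?_ ?_ fun r hr => ?_
          · exact Continuous.intervalIntegrable (by fun_prop) _ _
          · exact Continuous.intervalIntegrable (by fun_prop) _ _
          · have := hR.trans_le hr.1
            gcongr
            exact hr.2
      _ = _ := by
          simp only [intervalIntegral.integral_const_mul, integral_cos_pi_mul_sub_sq]
          ring
  have hden : C * ((R ^ m / 2 - 4 * δ * (R + 1) ^ m) / (R + 1) ^ 2) ≤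
      ∫ x in Ω, annulusTest R δ x ^ 2 / ‖x‖ ^ 2 := by
    calc C * ((R ^ m / 2 - 4 * δ * (R + 1) ^ m) / (R + 1) ^ 2)
        = C * ∫ r in R..R + 1,
            (R ^ m * sin (π * (r - R)) ^ 2 - (R + 1) ^ m * (4 * δ)) / (R + 1) ^ 2 := by
          rw [intervalIntegral.integral_div, intervalIntegral.integral_sub
            (Continuous.intervalIntegrable (by fun_prop) _ _)
            (Continuous.intervalIntegrable (by fun_prop) _ _),
            intervalIntegral.integral_const_mul, integral_sin_pi_mul_sub_sq,
            intervalIntegral.integral_const, add_sub_cancel_left, one_smul]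
          ring
      _ ≤ C * ∫ r in R..R + 1, r ^ m * ((sin (π * (r - R)) ^ 2 - 4 * δ) / (R + 1) ^ 2) := by
          gcongr
          refine intervalIntegral.integral_mono_on hRR ?_ ?_ fun r hr => ?_
          · exact Continuous.intervalIntegrable (by fun_prop) _ _
          · exact Continuous.intervalIntegrable (by fun_prop) _ _
          · rw [← mul_div_assoc, mul_sub (r ^ m)]
            have h1 : R ^ m ≤ r ^ m := pow_le_pow_left₀ hR.le hr.1 m
            have h2 : r ^ m ≤ (R + 1) ^ m := pow_le_pow_left₀ (hR.le.trans hr.1) hr.2 m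
            gcongr
      _ = ∫ x in Ω, (fun r => (sin (π * (r - R)) ^ 2 - 4 * δ) / (R + 1) ^ 2) ‖x‖ := by
          rw [hm, hC]
          exact (setIntegral_annulus_fun_norm (E := E) _ hR.le hRR).symm
      _ ≤ _ := by
          refine setIntegral_mono_on (ContinuousOn.integrableOn_annulus (by fun_prop)) ?_ hΩ
            fun x hx => ?_
          · refine ContinuousOn.integrableOn_annulus ?_
            refine ContinuousOn.div ?_ (by fun_prop) fun x hx => ?_
            · exact ((contDiff_annulusTest hR hδ).continuous.pow 2).continuousOn
            · have := hR.trans_le hx.1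
              positivity
          · have hs := sin_pi_mul_sub_pos hx.1 hx.2
            have h1 := sq_sub_le_softCut_sq hδ.le hs
            have h2 := mul_le_mul_of_nonneg_left (sin_le_one (π * (‖x‖ - R))) hδ.le
            rw [annulusTest, indicator_of_mem hx]
            have := hR.trans hx.1
            have := hx.2
            calc (sin (π * (‖x‖ - R)) ^ 2 - 4 * δ) / (R + 1) ^ 2
                ≤ softCut δ (sin (π * (‖x‖ - R))) ^ 2 / (R + 1) ^ 2 := by
                  gcongr
                  linarith
              _ ≤ _ := by gcongr
  have hlow : 0 < C * ((R ^ m / 2 - 4 * δ * (R + 1) ^ m) / (R + 1) ^ 2) := by positivity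
  refine ⟨hlow.trans_le hden, (div_le_div₀ (by positivity) hnum hlow hden).trans_eq ?_⟩
  field_simp

end AnnulusHardy

theorem tendsto_annulus_upper_bound (m : ℕ) :
    Tendsto (fun R : ℝ => (R + 1) ^ m * (π ^ 2 / 2) * (R + 1) ^ 2 /
      (R ^ m / 2 - 4 * R⁻¹ * (R + 1) ^ m) / R ^ 2) atTop (𝓝 (π ^ 2)) ∧
    ∀ᶠ R : ℝ in atTop, 0 < R ^ m / 2 - 4 * R⁻¹ * (R + 1) ^ m := by
  have hi : Tendsto (fun R : ℝ => R⁻¹) atTop (𝓝 0) := tendsto_inv_atTop_zero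
  have hq : Tendsto (fun R : ℝ => 1 + R⁻¹) atTop (𝓝 1) := by simpa using hi.const_add 1
  have hd : Tendsto (fun R : ℝ => 1 / 2 - 4 * R⁻¹ * (1 + R⁻¹) ^ m) atTop (𝓝 (1 / 2)) := by
    simpa only [mul_zero, one_pow, mul_one, sub_zero] using
      ((hi.const_mul 4).mul (hq.pow m)).const_sub (1 / 2 : ℝ)
  have heq {R : ℝ} (hR : 0 < R) : R ^ m / 2 - 4 * R⁻¹ * (R + 1) ^ m =
      R ^ m * (1 / 2 - 4 * R⁻¹ * (1 + R⁻¹) ^ m) := by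
    have : R + 1 = R * (1 + R⁻¹) := by field_simp
    rw [this, mul_pow]
    ring
  constructor
  · have hlim : Tendsto (fun R : ℝ => (1 + R⁻¹) ^ m * (π ^ 2 / 2) * (1 + R⁻¹) ^ 2 /
        (1 / 2 - 4 * R⁻¹ * (1 + R⁻¹) ^ m)) atTop (𝓝 (π ^ 2)) := by
      convert! (((hq.pow m).mul_const (π ^ 2 / 2)).mul (hq.pow 2)).div hd (by norm_num) using 2
      simp
    refine hlim.congr' ?_
    filter_upwards [eventually_gt_atTop 0] with R hR
    have : R + 1 = R * (1 + R⁻¹) := by field_simp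
    rw [heq hR, this, mul_pow, mul_pow]
    generalize 1 + R⁻¹ = q
    generalize 1 / 2 - 4 * R⁻¹ * q ^ m = d
    field_simp
  · filter_upwards [eventually_gt_atTop 0, hd.eventually_const_lt (by norm_num : (0 : ℝ) < 1 / 2)]
      with R hR h
    rw [heq hR]
    positivity

/-- Let `λ_R` be the optimal Hardy constant (the first eigenvalue of `-Δw = λ w/|x|²`
with Dirichlet conditions) on the annulus `Ω_R = {R < |x| < R+1}` in `ℝᴺ`, `N ≥ 3`.
Then `λ_R / R² → π²` as `R → ∞`. -/
theorem stmt_17 (N : ℕ) (hN : 3 ≤ N) (lam : ℝ → ℝ)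
    (hlam : ∀ R : ℝ, 0 < R →
      lam R = sInf {q : ℝ | ∃ w : EuclideanSpace ℝ (Fin N) → ℝ,
        ContDiff ℝ 1 w ∧ HasCompactSupport w ∧
        tsupport w ⊆ {x : EuclideanSpace ℝ (Fin N) | R < ‖x‖ ∧ ‖x‖ < R + 1} ∧
        (∫ x in {x : EuclideanSpace ℝ (Fin N) | R < ‖x‖ ∧ ‖x‖ < R + 1},
            w x ^ 2 / ‖x‖ ^ 2) ≠ 0 ∧
        q = (∫ x in {x : EuclideanSpace ℝ (Fin N) | R < ‖x‖ ∧ ‖x‖ < R + 1},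
              ‖gradient w x‖ ^ 2) /
            ∫ x in {x : EuclideanSpace ℝ (Fin N) | R < ‖x‖ ∧ ‖x‖ < R + 1},
              w x ^ 2 / ‖x‖ ^ 2}) :
    Tendsto (fun R => lam R / R ^ 2) atTop (𝓝 (π ^ 2)) := by
  have hfin : Module.finrank ℝ (EuclideanSpace ℝ (Fin N)) = N := finrank_euclideanSpace_fin
  have : Nontrivial (EuclideanSpace ℝ (Fin N)) :=
    Module.nontrivial_of_finrank_pos (R := ℝ) (by omega)
  obtain ⟨hlim, hpos⟩ := tendsto_annulus_upper_bound (N - 1)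
  have hle {R q : ℝ} (hR : 0 < R) (hq : q ∈ {q : ℝ | ∃ w : EuclideanSpace ℝ (Fin N) → ℝ,
        ContDiff ℝ 1 w ∧ HasCompactSupport w ∧
        tsupport w ⊆ {x : EuclideanSpace ℝ (Fin N) | R < ‖x‖ ∧ ‖x‖ < R + 1} ∧
        (∫ x in {x : EuclideanSpace ℝ (Fin N) | R < ‖x‖ ∧ ‖x‖ < R + 1},
            w x ^ 2 / ‖x‖ ^ 2) ≠ 0 ∧
        q = (∫ x in {x : EuclideanSpace ℝ (Fin N) | R < ‖x‖ ∧ ‖x‖ < R + 1},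
              ‖gradient w x‖ ^ 2) /
            ∫ x in {x : EuclideanSpace ℝ (Fin N) | R < ‖x‖ ∧ ‖x‖ < R + 1},
              w x ^ 2 / ‖x‖ ^ 2}) : π ^ 2 * R ^ 2 ≤ q := by
    obtain ⟨w, hw, hc, hs, h0, rfl⟩ := hq
    rw [le_div_iff₀ ((integral_nonneg fun x => by positivity).lt_of_ne' h0)]
    exact annulus_hardy_inequality (by omega) hR hw hc hs
  have hmem {R : ℝ} (hR : 0 < R) (hRpos : 0 < R ^ (N - 1) / 2 - 4 * R⁻¹ * (R + 1) ^ (N - 1)) :=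
    annulusTest_rayleigh_bounds (E := EuclideanSpace ℝ (Fin N)) hR (inv_pos.2 hR)
      (by rw [hfin]) hRpos
  have hcpt {R : ℝ} (hR : 0 < R) :
      HasCompactSupport (annulusTest R R⁻¹ : EuclideanSpace ℝ (Fin N) → ℝ) :=
    (isCompact_closed_annulus R (R + 1)).of_isClosed_subset (isClosed_tsupport _)
      ((tsupport_annulusTest_subset (inv_pos.2 hR)).trans fun _ hx => ⟨hx.1.le, hx.2.le⟩)
  refine tendsto_of_tendsto_of_tendsto_of_le_of_le' tendsto_const_nhds hlim ?_ ?_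
  · filter_upwards [eventually_gt_atTop 0, hpos] with R hR hRpos
    rw [le_div_iff₀ (by positivity), hlam R hR]
    exact le_csInf ⟨_, _, contDiff_annulusTest hR (inv_pos.2 hR), hcpt hR,
      tsupport_annulusTest_subset (inv_pos.2 hR), (hmem hR hRpos).1.ne', rfl⟩ fun q hq => hle hR hq
  · filter_upwards [eventually_gt_atTop 0, hpos] with R hR hRpos
    gcongr
    rw [hlam R hR]
    exact (csInf_le ⟨_, fun q hq => hle hR hq⟩ ⟨_, contDiff_annulusTest hR (inv_pos.2 hR), hcpt hR,
      tsupport_annulusTest_subset (inv_pos.2 hR), (hmem hR hRpos).1.ne', rfl⟩).trans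
      (hmem hR hRpos).2
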